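/- Let k(x,y) = ⟪φ(x), φ(y)⟫ for a bounded measurable map φ : X → H into a real separable Hilbert space, with Δk := sup k − inf k and Δdiag k := sup_x k(x,x) − inf_x k(x,x), Δdiag k + 2Δk > 0. Let X_1, …, X_n be i.i.d. from P (n ≥ 2), v = E[k(X,X)] − E[k(X,X')] (X, X' independent P-distributed) and v̂ the empirical variance proxy. Then for each b ∈ {−1, 1} and δ ∈ (0,1), with probability at least 1 − δ: b·[ √(v̂ + Δdiag k) − √(v + Δdiag k) ] ≤ 2 √( (Δdiag k + 2Δk) log(1/δ)/n ). -/

import Mathlib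

open MeasureTheory
open scoped RealInnerProductSpace

open ProbabilityTheory in
/-- Under an i.i.d. product measure, any injective selection of coordinates is again i.i.d. -/
theorem measurePreserving_comp_injective {ι κ X : Type*} [Fintype ι] [Fintype κ]
    [MeasurableSpace X] (P : Measure X) [IsProbabilityMeasure P] {g : κ → ι}
    (hg : Function.Injective g) :
    MeasurePreserving (fun ω : ι → X => fun i => ω (g i))
      (Measure.pi fun _ => P) (Measure.pi fun _ => P) where
  measurable := by fun_prop
  map_eq := by
    have h : iIndepFun (fun (i : ι) (ω : ι → X) => ω i) (Measure.pi fun _ : ι => P) :=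
      iIndepFun_pi (X := fun _ x => x) fun _ => aemeasurable_id
    rw [(h.precomp hg).map_fun_eq_pi_map fun i => (measurable_pi_apply _).aemeasurable]
    congr 1
    funext i
    exact (measurePreserving_eval (fun _ : ι => P) (g i)).map_eq

/-- Expectations of products over disjoint pairs of i.i.d. coordinates factorize. -/
theorem integral_prod_disjoint_pairs {ι κ X : Type*} [Fintype ι] [Fintype κ]
    [MeasurableSpace X] (P : Measure X) [IsProbabilityMeasure P] {f : κ ⊕ κ → ι}
    (hf : Function.Injective f) {g : X × X → ℝ} (hg : Measurable g) :
    ∫ ω, ∏ i, g (ω (f (Sum.inl i)), ω (f (Sum.inr i))) ∂(Measure.pi fun _ : ι => P) =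
      (∫ p, g p ∂(P.prod P)) ^ Fintype.card κ := by
  have h₁ := measurePreserving_comp_injective P hf
  have h₂ := measurePreserving_sumPiEquivProdPi (X := fun _ : κ ⊕ κ => X) fun _ => P
  have h₃ := (measurePreserving_arrowProdEquivProdArrow X X κ (fun _ => P) fun _ => P).symm
  have h := (h₃.comp h₂).comp h₁
  have hG : AEStronglyMeasurable (fun q : κ → X × X => ∏ i, g (q i))
      (Measure.pi fun _ => P.prod P) := by
    apply Measurable.aestronglyMeasurable
    fun_prop
  calc _ = ∫ q, ∏ i, g (q i) ∂(Measure.pi fun _ : κ => P.prod P) := by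
        rw [← h.map_eq, integral_map h.measurable.aemeasurable (h.map_eq ▸ hG)]
        rfl
    _ = _ := by
        rw [integral_fintype_prod_eq_pow]

theorem exists_perm_apply_pair {ι : Type*} [DecidableEq ι] {a b a' b' : ι} (h : a ≠ b)
    (h' : a' ≠ b') : ∃ τ : Equiv.Perm ι, τ a = a' ∧ τ b = b' := by
  have hb : a' ≠ Equiv.swap a a' b := fun e => h <| by
    rw [← (Equiv.swap a a').injective.eq_iff, ← e, Equiv.swap_apply_left]
  exact ⟨Equiv.swap (Equiv.swap a a' b) b' * Equiv.swap a a',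
    by simp [Equiv.swap_apply_of_ne_of_ne hb h'], by simp⟩

/-- Averaging an off-diagonal entry over all permutations gives the off-diagonal average. -/
theorem sum_perm_apply_pair {ι : Type*} [Fintype ι] [DecidableEq ι] {w : ι → ι → ℝ}
    (hw : ∀ i, w i i = 0) {a b : ι} (hab : a ≠ b) :
    ((Fintype.card ι : ℝ) * (Fintype.card ι - 1)) *
        ∑ σ : Equiv.Perm ι, w (σ a) (σ b) =
      Fintype.card (Equiv.Perm ι) * ∑ i, ∑ j, w i j := by
  have key : ∀ i j, ∑ σ : Equiv.Perm ι, w (σ i) (σ j) =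
      (∑ σ : Equiv.Perm ι, w (σ a) (σ b)) -
        if i = j then ∑ σ : Equiv.Perm ι, w (σ a) (σ b) else 0 := by
    intro i j
    split_ifs with hij
    · simp [hij, hw]
    · obtain ⟨τ, rfl, rfl⟩ := exists_perm_apply_pair hab hij
      rw [sub_zero]
      exact Fintype.sum_equiv (Equiv.mulRight τ) _ _ fun σ => rfl
  have h₁ : ∑ i, ∑ j, ∑ σ : Equiv.Perm ι, w (σ i) (σ j) =
      Fintype.card (Equiv.Perm ι) * ∑ i, ∑ j, w i j := by
    have : ∀ σ : Equiv.Perm ι, ∑ i, ∑ j, w (σ i) (σ j) = ∑ i, ∑ j, w i j := fun σ =>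
      (Fintype.sum_congr _ _ fun i => Equiv.sum_comp σ _).trans
        (Equiv.sum_comp σ fun i => ∑ j, w i j)
    calc _ = ∑ σ : Equiv.Perm ι, ∑ i, ∑ j, w (σ i) (σ j) :=
          (Fintype.sum_congr _ _ fun i => Finset.sum_comm).trans Finset.sum_comm
      _ = _ := by simp [this]
  rw [← h₁]
  generalize ∑ σ : Equiv.Perm ι, w (σ a) (σ b) = A at key
  simp_rw [key]
  simp [Finset.sum_sub_distrib]
  ring

theorem exp_mul_le_of_mem_Icc {x : ℝ} (t : ℝ) (hx : x ∈ Set.Icc (0 : ℝ) 1) :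
    Real.exp (t * x) ≤ 1 + x * (Real.exp t - 1) := by
  have h := convexOn_exp.2 (Set.mem_univ t) (Set.mem_univ 0) hx.1 (sub_nonneg.2 hx.2)
    (by ring)
  simp only [smul_eq_mul, mul_zero, add_zero, Real.exp_zero, mul_one] at h
  rw [mul_comm t x]
  linarith

theorem mgf_le_exp_of_mem_Icc {Ω : Type*} [MeasurableSpace Ω] {μ : Measure Ω}
    [IsProbabilityMeasure μ] {W : Ω → ℝ} (hW : Measurable W)
    (h01 : ∀ ω, W ω ∈ Set.Icc (0 : ℝ) 1) (t : ℝ) :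
    ∫ ω, Real.exp (t * W ω) ∂μ ≤ Real.exp ((∫ ω, W ω ∂μ) * (Real.exp t - 1)) := by
  have hint : Integrable W μ := Integrable.of_mem_Icc 0 1 hW.aemeasurable (ae_of_all _ h01)
  calc _ ≤ ∫ ω, (1 + W ω * (Real.exp t - 1)) ∂μ :=
        integral_mono_of_nonneg (ae_of_all _ fun ω => (Real.exp_pos _).le)
          ((integrable_const _).add (hint.mul_const _))
          (ae_of_all _ fun ω => exp_mul_le_of_mem_Icc t (h01 ω))
    _ = (∫ ω, W ω ∂μ) * (Real.exp t - 1) + 1 := by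
        rw [integral_add (integrable_const _) (hint.mul_const _), integral_mul_const]
        simp [add_comm]
    _ ≤ _ := Real.add_one_le_exp _

/-- Hoeffding's averaging argument: a second-order U-statistic with values in `[0, 1]` has the
Poisson-type moment generating function of an average of disjoint pairs. -/
theorem mgf_uStatistic_le {ι κ X : Type*} [Fintype ι] [DecidableEq ι] [Fintype κ]
    [MeasurableSpace X] (P : Measure X) [IsProbabilityMeasure P] {f : κ ⊕ κ → ι}
    (hf : Function.Injective f) (hι : 2 ≤ Fintype.card ι) {w : X × X → ℝ} (hw : Measurable w)
    (h01 : ∀ p, w p ∈ Set.Icc (0 : ℝ) 1) (hdiag : ∀ x, w (x, x) = 0) (t : ℝ) :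
    ∫ ω : ι → X, Real.exp (t * (Fintype.card κ * ((∑ i, ∑ j, w (ω i, ω j)) /
        ((Fintype.card ι : ℝ) * (Fintype.card ι - 1))))) ∂(Measure.pi fun _ => P) ≤
      Real.exp ((Fintype.card κ * ∫ p, w p ∂(P.prod P)) * (Real.exp t - 1)) := by
  set N : ℝ := (Fintype.card (Equiv.Perm ι) : ℝ) with hN
  have hN0 : 0 < N := by rw [hN]; exact_mod_cast Fintype.card_pos
  have hn : (2 : ℝ) ≤ Fintype.card ι := by exact_mod_cast hι
  have hn0 : 0 < (Fintype.card ι : ℝ) * (Fintype.card ι - 1) := by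
    apply mul_pos <;> linarith
  have havg : ∀ ω : ι → X, t * (Fintype.card κ * ((∑ i, ∑ j, w (ω i, ω j)) /
      ((Fintype.card ι : ℝ) * (Fintype.card ι - 1)))) =
      ∑ σ : Equiv.Perm ι, N⁻¹ •
        ∑ i : κ, t * w (ω (σ (f (Sum.inl i))), ω (σ (f (Sum.inr i)))) := by
    intro ω
    have hpair : ∀ i : κ,
        ∑ σ : Equiv.Perm ι, w (ω (σ (f (Sum.inl i))), ω (σ (f (Sum.inr i)))) =
          N * ((∑ i, ∑ j, w (ω i, ω j)) /
            ((Fintype.card ι : ℝ) * (Fintype.card ι - 1))) := by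
      intro i
      have := sum_perm_apply_pair (w := fun i j => w (ω i, ω j)) (fun i => hdiag _)
        (hf.ne (Sum.inl_ne_inr (a := i) (b := i)))
      rw [← mul_div_assoc, eq_div_iff hn0.ne', ← this, mul_comm]
    rw [← Finset.smul_sum, Finset.sum_comm (s := (Finset.univ : Finset (Equiv.Perm ι)))]
    simp_rw [← Finset.mul_sum, hpair]
    simp only [Finset.sum_const, Finset.card_univ, nsmul_eq_mul, smul_eq_mul]
    field_simp
  have hmeas : ∀ σ : Equiv.Perm ι, Measurable fun ω : ι → X =>
      ∏ i : κ, Real.exp (t * w (ω (σ (f (Sum.inl i))), ω (σ (f (Sum.inr i))))) := by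
    intro σ
    fun_prop
  have hint : ∀ σ : Equiv.Perm ι, Integrable (fun ω : ι → X =>
      ∏ i : κ, Real.exp (t * w (ω (σ (f (Sum.inl i))), ω (σ (f (Sum.inr i))))))
      (Measure.pi fun _ => P) := by
    intro σ
    refine Integrable.of_bound (hmeas σ).aestronglyMeasurable
      (∏ i : κ, Real.exp |t|) (ae_of_all _ fun ω => ?_)
    rw [norm_prod]
    refine Finset.prod_le_prod (fun _ _ => norm_nonneg _) fun i _ => ?_
    rw [Real.norm_of_nonneg (Real.exp_pos _).le, Real.exp_le_exp]
    refine (le_abs_self _).trans ?_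
    rw [abs_mul]
    refine mul_le_of_le_one_right (abs_nonneg _) ?_
    rw [abs_of_nonneg (h01 _).1]
    exact (h01 _).2
  calc _ ≤ ∫ ω : ι → X, ∑ σ : Equiv.Perm ι, N⁻¹ *
          ∏ i : κ, Real.exp (t * w (ω (σ (f (Sum.inl i))), ω (σ (f (Sum.inr i)))))
          ∂(Measure.pi fun _ => P) := by
        refine integral_mono_of_nonneg (ae_of_all _ fun ω => (Real.exp_pos _).le)
          (integrable_finsetSum _ fun σ _ => (hint σ).const_mul _) (ae_of_all _ fun ω => ?_)
        simp only [havg, ← Real.exp_sum]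
        refine convexOn_exp.map_sum_le (fun _ _ => (inv_pos.2 hN0).le) ?_ fun _ _ =>
          Set.mem_univ _
        simp [hN]
    _ = (∫ p, Real.exp (t * w p) ∂(P.prod P)) ^ Fintype.card κ := by
        rw [integral_finsetSum _ fun σ _ => (hint σ).const_mul _]
        simp_rw [integral_const_mul]
        have : ∀ σ : Equiv.Perm ι, ∫ ω : ι → X, ∏ i : κ, Real.exp
            (t * w (ω (σ (f (Sum.inl i))), ω (σ (f (Sum.inr i))))) ∂(Measure.pi fun _ => P) =
            (∫ p, Real.exp (t * w p) ∂(P.prod P)) ^ Fintype.card κ := fun σ =>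
          integral_prod_disjoint_pairs P (f := σ ∘ f) (σ.injective.comp hf)
            (g := fun p => Real.exp (t * w p)) (by fun_prop)
        simp [this, hN]
    _ ≤ Real.exp ((∫ p, w p ∂(P.prod P)) * (Real.exp t - 1)) ^ Fintype.card κ := by
        refine pow_le_pow_left₀ (integral_nonneg fun _ => ?_) (mgf_le_exp_of_mem_Icc hw h01 t) _
        exact (Real.exp_pos _).le
    _ = _ := by
        rw [← Real.exp_nat_mul]
        ring_nf

/-- Square-root concentration from a Poisson-type moment generating function. -/
theorem measureReal_sqrt_deviation_le {Ω : Type*} [MeasurableSpace Ω] {μ : Measure Ω}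
    [IsProbabilityMeasure μ] {Z : Ω → ℝ} {m c : ℝ} (hm : 0 ≤ m)
    (hZ : Measurable Z) (hbd : ∀ ω, Z ω ∈ Set.Icc 0 c)
    (hmgf : ∀ t, ∫ ω, Real.exp (t * Z ω) ∂μ ≤ Real.exp (m * (Real.exp t - 1)))
    {s : ℝ} (hs : 0 < s) {b : ℝ} (hb : b = -1 ∨ b = 1) :
    μ.real {ω | s < b * (√(Z ω) - √m)} ≤ Real.exp (-s ^ 2) := by
  have hint : ∀ t, Integrable (fun ω => Real.exp (t * Z ω)) μ := by
    intro t
    refine Integrable.of_bound (by fun_prop) (Real.exp (|t| * c)) (ae_of_all _ fun ω => ?_)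
    rw [Real.norm_of_nonneg (Real.exp_pos _).le, Real.exp_le_exp]
    exact mul_le_mul (le_abs_self t) (hbd ω).2 (hbd ω).1 (abs_nonneg t)
  -- the optimal Chernoff parameter is `log ((√m + b s)² / m)`
  have hexp : ∀ r : ℝ, 0 < r → 0 < m →
      Real.exp (-(2 * Real.log (r / √m)) * r ^ 2) *
        Real.exp (m * (Real.exp (2 * Real.log (r / √m)) - 1)) ≤
      Real.exp (-(r - √m) ^ 2) := by
    intro r hr hm
    have hm' := Real.sqrt_pos.2 hm
    have hsq := Real.sq_sqrt hm.le
    have hlog := Real.one_sub_inv_le_log_of_pos (div_pos hr hm')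
    have he : Real.exp (2 * Real.log (r / √m)) = (r / √m) ^ 2 := by
      rw [two_mul, Real.exp_add, Real.exp_log (div_pos hr hm'), sq]
    rw [he, ← Real.exp_add, Real.exp_le_exp, div_pow, hsq]
    have h₁ : m * (r ^ 2 / m - 1) = r ^ 2 - m := by field_simp
    have h₂ : r ^ 2 * (1 - (r / √m)⁻¹) = r ^ 2 - r * √m := by field_simp
    have h₃ := mul_le_mul_of_nonneg_left hlog (sq_nonneg r)
    rw [h₂] at h₃
    rw [h₁]
    nlinarith
  rcases hb with rfl | rfl
  · rcases le_or_gt (√m) s with hms | hms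
    · have : {ω | s < -1 * (√(Z ω) - √m)} = ∅ := by
        ext ω
        simp only [Set.mem_ofPred_eq, Set.mem_empty_iff_false, iff_false, not_lt]
        linarith [Real.sqrt_nonneg (Z ω)]
      rw [this, measureReal_empty]
      exact (Real.exp_pos _).le
    · have hm0 : 0 < m := Real.sqrt_pos.1 (hs.trans hms)
      set t := 2 * Real.log ((√m - s) / √m)
      have ht : t ≤ 0 := by
        have : Real.log ((√m - s) / √m) ≤ 0 := Real.log_nonpos
          (div_nonneg (by linarith) (Real.sqrt_nonneg _))
          ((div_le_one (hs.trans hms)).2 (by linarith))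
        simp only [t]; linarith
      calc _ ≤ μ.real {ω | Z ω ≤ (√m - s) ^ 2} := by
            refine measureReal_mono fun ω hω => ?_
            simp only [Set.mem_ofPred_eq] at hω ⊢
            rw [← Real.sq_sqrt (hbd ω).1]
            exact pow_le_pow_left₀ (Real.sqrt_nonneg _) (by linarith) 2
        _ ≤ _ := ProbabilityTheory.measure_le_le_exp_mul_mgf _ ht (hint t)
        _ ≤ _ := mul_le_mul_of_nonneg_left (hmgf t) (Real.exp_pos _).le
        _ ≤ _ := (hexp _ (by linarith) hm0).trans_eq (by ring_nf)
  · have htail : ∀ t, 0 ≤ t → μ.real {ω | s < 1 * (√(Z ω) - √m)} ≤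
        Real.exp (-t * (√m + s) ^ 2) * Real.exp (m * (Real.exp t - 1)) := by
      intro t ht
      calc _ ≤ μ.real {ω | (√m + s) ^ 2 ≤ Z ω} := by
            refine measureReal_mono fun ω hω => ?_
            simp only [Set.mem_ofPred_eq] at hω ⊢
            rw [← Real.sq_sqrt (hbd ω).1]
            have := Real.sqrt_nonneg m
            exact pow_le_pow_left₀ (by linarith) (by linarith) 2
        _ ≤ _ := ProbabilityTheory.measure_ge_le_exp_mul_mgf _ ht (hint t)
        _ ≤ _ := mul_le_mul_of_nonneg_left (hmgf t) (Real.exp_pos _).le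
    rcases hm.eq_or_lt with rfl | hm0
    · simpa using htail 1 zero_le_one
    · have hm' := Real.sqrt_pos.2 hm0
      refine (htail (2 * Real.log ((√m + s) / √m)) ?_).trans
        ((hexp _ (by linarith) hm0).trans_eq (by ring_nf))
      have := Real.log_nonneg ((one_le_div hm').2 (by linarith : √m ≤ √m + s))
      linarith

theorem sqrt_add_sub_sqrt_add_le {x y d : ℝ} (hy : 0 ≤ y) (hyx : y ≤ x) (hd : 0 ≤ d) :
    √(x + d) - √(y + d) ≤ √x - √y := by
  have hx := hy.trans hyx
  have h : √(x + d) * √y ≤ √x * √(y + d) := by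
    rw [← Real.sqrt_mul (by linarith), ← Real.sqrt_mul hx]
    exact Real.sqrt_le_sqrt (by nlinarith)
  refine sub_le_sub_iff.2 (abs_le_of_sq_le_sq' ?_ (by positivity)).2
  rw [add_sq, add_sq, Real.sq_sqrt hx, Real.sq_sqrt hy, Real.sq_sqrt (by linarith),
    Real.sq_sqrt (by linarith)]
  linarith

theorem mul_sqrt_sub_sqrt_le_of_add {x y d r b : ℝ} (hx : 0 ≤ x) (hy : 0 ≤ y) (hd : 0 ≤ d)
    (hr : 0 ≤ r) (hb : b = -1 ∨ b = 1) (h : b * (√x - √y) ≤ r) :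
    b * (√(x + d) - √(y + d)) ≤ r := by
  rcases hb with rfl | rfl <;> rcases le_total x y with hxy | hxy
  · linarith [sqrt_add_sub_sqrt_add_le hx hxy hd]
  · linarith [Real.sqrt_le_sqrt (add_le_add_left hxy d)]
  · linarith [Real.sqrt_le_sqrt (add_le_add_left hxy d)]
  · linarith [sqrt_add_sub_sqrt_add_le hy hxy hd]

/-- For a general bounded kernel `k(x,y) = ⟪φ(x), φ(y)⟫`, for
`b ∈ {−1,1}`, with probability at least `1 − δ`,
`b·[√(v̂ + Δdiag k) − √(v + Δdiag k)] ≤ 2√((Δdiag k + 2Δk) log(1/δ)/n)`. -/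
theorem sqrt_empirical_variance_concentration_general
    {X : Type*} [MeasurableSpace X] [Nonempty X]
    {H : Type*} [NormedAddCommGroup H] [InnerProductSpace ℝ H] [CompleteSpace H]
    [SecondCountableTopology H] [MeasurableSpace H] [BorelSpace H]
    (φ : X → H) (hφ_meas : Measurable φ) (C : ℝ) (hφ_bdd : ∀ x, ‖φ x‖ ≤ C)
    (k : X → X → ℝ) (hk : ∀ x y, k x y = ⟪φ x, φ y⟫)
    (kSup kInf : ℝ)
    (hkSup : IsLUB (Set.range fun p : X × X => k p.1 p.2) kSup)
    (hkInf : IsGLB (Set.range fun p : X × X => k p.1 p.2) kInf)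
    (dSup dInf : ℝ)
    (hdSup : IsLUB (Set.range fun x => k x x) dSup)
    (hdInf : IsGLB (Set.range fun x => k x x) dInf)
    (Δk Δdiag : ℝ) (hΔk : Δk = kSup - kInf) (hΔdiag : Δdiag = dSup - dInf)
    (hpos : 0 < Δdiag + 2 * Δk)
    (P : Measure X) [IsProbabilityMeasure P]
    (n : ℕ) (hn : 2 ≤ n)
    (v : ℝ) (hv : v = (∫ x, k x x ∂P) - ∫ p, k p.1 p.2 ∂(P.prod P))
    (vhat : (Fin n → X) → ℝ)
    (hvhat : ∀ x, vhat x = (1 / ((n : ℝ) - 1)) *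
      ∑ t : Fin n, (k (x t) (x t) - (1 / (n : ℝ)) * ∑ s : Fin n, k (x t) (x s)))
    (b : ℝ) (hb : b = -1 ∨ b = 1)
    (δ : ℝ) (hδ : δ ∈ Set.Ioo (0 : ℝ) 1) :
    ENNReal.ofReal (1 - δ) ≤
      (Measure.pi fun _ : Fin n => P)
        {ω | b * (Real.sqrt (vhat ω + Δdiag) - Real.sqrt (v + Δdiag)) ≤
          2 * Real.sqrt ((Δdiag + 2 * Δk) * Real.log (1 / δ) / n)} := by
  have x₀ := Classical.arbitrary X
  have hn' : (2 : ℝ) ≤ n := by exact_mod_cast hn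
  have hkS : ∀ x y, k x y ≤ kSup := fun x y => hkSup.1 ⟨(x, y), rfl⟩
  have hkI : ∀ x y, kInf ≤ k x y := fun x y => hkInf.1 ⟨(x, y), rfl⟩
  have hD : 0 ≤ Δdiag := by
    have h₁ : k x₀ x₀ ≤ dSup := hdSup.1 ⟨x₀, rfl⟩
    have h₂ : dInf ≤ k x₀ x₀ := hdInf.1 ⟨x₀, rfl⟩
    linarith
  set B := Δdiag + 2 * Δk
  have hk_meas : Measurable fun p : X × X => k p.1 p.2 := by
    simp_rw [hk]
    fun_prop
  have hd_meas : Measurable fun x => k x x := hk_meas.comp (measurable_id.prodMk measurable_id)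
  have hk_int : Integrable (fun p : X × X => k p.1 p.2) (P.prod P) :=
    Integrable.of_mem_Icc kInf kSup hk_meas.aemeasurable
      (ae_of_all _ fun p => ⟨hkI _ _, hkS _ _⟩)
  have hd_int : Integrable (fun x => k x x) P :=
    Integrable.of_mem_Icc kInf kSup hd_meas.aemeasurable (ae_of_all _ fun p => ⟨hkI _ _, hkS _ _⟩)
  set w : X × X → ℝ := fun p => (k p.1 p.1 + k p.2 p.2 - 2 * k p.1 p.2) / B with hw
  have hw_meas : Measurable w := by
    have h₁ : Measurable fun p : X × X => k p.1 p.1 := hd_meas.comp measurable_fst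
    have h₂ : Measurable fun p : X × X => k p.2 p.2 := hd_meas.comp measurable_snd
    fun_prop
  have hw01 : ∀ p, w p ∈ Set.Icc (0 : ℝ) 1 := by
    rintro ⟨x, y⟩
    refine ⟨div_nonneg ?_ hpos.le, (div_le_one hpos).2 ?_⟩
    · have := norm_sub_sq_real (φ x) (φ y)
      simp only [hk, real_inner_self_eq_norm_sq]
      nlinarith [sq_nonneg ‖φ x - φ y‖]
    · have h₁ := hkS x x
      have h₂ := hkS y y
      have h₃ := hkI x y
      simp only
      linarith
  have hw_diag : ∀ x, w (x, x) = 0 := fun x => by simp only [hw]; ring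
  have hw_integral : ∫ p, w p ∂(P.prod P) = 2 * v / B := by
    have h₁ : Integrable (fun p : X × X => k p.1 p.1) (P.prod P) := hd_int.comp_fst P
    have h₂ : Integrable (fun p : X × X => k p.2 p.2) (P.prod P) := hd_int.comp_snd P
    have h₃ : ∫ p : X × X, k p.1 p.1 ∂(P.prod P) = ∫ x, k x x ∂P := by
      simpa using integral_fun_fst (μ := P) (ν := P) (fun x => k x x)
    have h₄ : ∫ p : X × X, k p.2 p.2 ∂(P.prod P) = ∫ x, k x x ∂P := by
      simpa using integral_fun_snd (μ := P) (ν := P) (fun x => k x x)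
    simp only [hw]
    have h₅ : Integrable (fun p : X × X => k p.1 p.1 + k p.2 p.2) (P.prod P) := h₁.add h₂
    rw [integral_div, integral_sub h₅ (hk_int.const_mul 2), integral_add h₁ h₂,
      integral_const_mul, h₃, h₄, hv]
    ring
  have hv0 : 0 ≤ v := by
    have h : 0 ≤ 2 * v / B := hw_integral ▸ integral_nonneg fun p => (hw01 p).1
    rw [le_div_iff₀ hpos] at h
    linarith
  have hvhat_eq : ∀ x : Fin n → X,
      (∑ i, ∑ j, w (x i, x j)) / ((n : ℝ) * (n - 1)) = 2 * vhat x / B := by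
    intro x
    have h₁ : (n : ℝ) - 1 ≠ 0 := by linarith
    have h₂ : (n : ℝ) ≠ 0 := by linarith
    rw [hvhat]
    simp only [hw, ← Finset.sum_div, Finset.sum_sub_distrib, Finset.sum_add_distrib,
      ← Finset.mul_sum, Finset.sum_const, Finset.card_univ, Fintype.card_fin, nsmul_eq_mul]
    field_simp
    ring
  set m := n / 2
  have hm_pos : (0 : ℝ) < m := by
    have : 0 < m := by omega
    exact_mod_cast this
  have hnm : (n : ℝ) ≤ 8 * m := by
    have : n ≤ 8 * m := by omega
    exact_mod_cast this
  set f : Fin m ⊕ Fin m → Fin n := Fin.castLE (by omega) ∘ finSumFinEquiv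
  have hf : Function.Injective f :=
    (Fin.castLE_injective _).comp finSumFinEquiv.injective
  set c : ℝ := 2 * m / B with hc_def
  have hc : 0 < c := by positivity
  have hscale : ∀ x : Fin n → X,
      (m : ℝ) * ((∑ i, ∑ j, w (x i, x j)) / ((n : ℝ) * (n - 1))) = c * vhat x := fun x => by
    rw [hvhat_eq]; ring
  have hmgf := mgf_uStatistic_le P hf (by simpa using hn) hw_meas hw01 hw_diag
  simp only [Fintype.card_fin, hscale, hw_integral] at hmgf
  have hvm : (m : ℝ) * (2 * v / B) = c * v := by ring
  rw [hvm] at hmgf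
  have hvhat_meas : Measurable vhat := by
    have : vhat = fun x => (m : ℝ) * ((∑ i, ∑ j, w (x i, x j)) / ((n : ℝ) * (n - 1))) / c := by
      funext x
      rw [hscale, mul_div_cancel_left₀ _ hc.ne']
    rw [this]
    fun_prop
  have hZ : ∀ x, c * vhat x ∈ Set.Icc 0 ((m : ℝ) * ((∑ _i : Fin n, ∑ _j : Fin n, 1) /
      ((n : ℝ) * (n - 1)))) := by
    intro x
    have h₁ : 0 ≤ (n : ℝ) * (n - 1) := mul_nonneg (by linarith) (by linarith)
    rw [← hscale]
    refine ⟨mul_nonneg hm_pos.le (div_nonneg (Finset.sum_nonneg fun i _ =>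
      Finset.sum_nonneg fun j _ => (hw01 _).1) h₁), ?_⟩
    gcongr
    exact (hw01 _).2
  have hvhat0 : ∀ x, 0 ≤ vhat x := fun x => (mul_nonneg_iff_of_pos_left hc).1 (hZ x).1
  have hL : 0 < Real.log (1 / δ) := Real.log_pos ((one_lt_div hδ.1).2 hδ.2)
  set r := 2 * √(B * Real.log (1 / δ) / n) with hr
  have hn0 : (0 : ℝ) < n := by linarith
  have hr0 : 0 < r := by positivity
  have htail := measureReal_sqrt_deviation_le (mul_nonneg hc.le hv0) (hvhat_meas.const_mul c) hZ
    hmgf (mul_pos (Real.sqrt_pos.2 hc) hr0) hb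
  have hδ_bound : Real.exp (-(√c * r) ^ 2) ≤ δ := by
    rw [← Real.le_log_iff_exp_le hδ.1, mul_pow, hr, mul_pow, Real.sq_sqrt hc.le,
      Real.sq_sqrt (by positivity)]
    have h₁ : c * (2 ^ 2 * (B * Real.log (1 / δ) / n)) = 8 * m / n * Real.log (1 / δ) := by
      rw [hc_def]; field_simp; ring
    have h₂ : Real.log (1 / δ) ≤ 8 * m / n * Real.log (1 / δ) :=
      le_mul_of_one_le_left hL.le ((one_le_div hn0).2 hnm)
    have h₃ : Real.log (1 / δ) = -Real.log δ := by rw [one_div, Real.log_inv]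
    rw [h₁]
    linarith
  set S := {ω | b * (√(vhat ω + Δdiag) - √(v + Δdiag)) ≤ r}
  have hS_meas : MeasurableSet S := measurableSet_le (by fun_prop) measurable_const
  have hcompl : (Measure.pi fun _ : Fin n => P).real Sᶜ ≤ δ := by
    refine (measureReal_mono fun ω hω => ?_).trans (htail.trans hδ_bound)
    by_contra hω'
    refine hω (mul_sqrt_sub_sqrt_le_of_add (hvhat0 ω) hv0 hD hr0.le hb ?_)
    rw [Set.mem_ofPred_eq, not_lt, Real.sqrt_mul hc.le, Real.sqrt_mul hc.le] at hω'
    refine le_of_mul_le_mul_left ?_ (Real.sqrt_pos.2 hc)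
    linarith
  rw [probReal_compl_eq_one_sub hS_meas] at hcompl
  exact ENNReal.ofReal_le_of_le_toReal (by rw [← measureReal_def]; linarith)
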